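/- Suppose F̄ is continuously differentiable with continuous density f = −F̄′, the SERPT rank function r_S is piecewise monotonic, and [0,∞) decomposes into a locally finite collection of maximal hills and valleys of r_S. Let y, z be the previous/next hill age functions of r_S. Then ∫₀^∞ (x/h(y(x))) · f(x) dx ≤ ∫₀^∞ J(z(x))/(h(y(x))·h(z(x))) · f(x) dx + (1/λ)·log(1/(1−ρ)). -/

import Mathlib

open MeasureTheory Set

/-- Increasing envelope of a rank function: `R(a) = sup_{0 ≤ b ≤ a} r(b)`. -/
noncomputable def incEnvelope (r : ℝ → ℝ) (a : ℝ) : ℝ := sSup (r '' Icc 0 a)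

/-- An age `a > 0` is a valley age of `r` if the increasing envelope of `r` is
locally constant around `a`. -/
def IsValleyAge (r : ℝ → ℝ) (a : ℝ) : Prop :=
  0 < a ∧ ∃ ε > 0, ∀ b ∈ Ioo (a - ε) (a + ε), incEnvelope r b = incEnvelope r a

/-- A hill age is a nonnegative age that is not a valley age (`0` is always a hill age). -/
def IsHillAge (r : ℝ → ℝ) (a : ℝ) : Prop := 0 ≤ a ∧ ¬ IsValleyAge r a

/-- Previous hill age `y(x) = sup {a < x : a hill age}` (equals `0` when `x = 0`). -/
noncomputable def prevHill (r : ℝ → ℝ) (x : ℝ) : ℝ := sSup {a | a < x ∧ IsHillAge r a}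

-- Next hill age, valued in `WithTop ℝ`: `z(x) = inf {a ≥ x : a hill age}`, and `∞`
-- if there is no hill age `≥ x`.
open Classical in
noncomputable def nextHillT (r : ℝ → ℝ) (x : ℝ) : WithTop ℝ :=
  if ∃ a, x ≤ a ∧ IsHillAge r a then ((sInf {a | x ≤ a ∧ IsHillAge r a} : ℝ) : WithTop ℝ)
  else ⊤

/-- Next hill age as a real number (used for finite decompositions). -/
noncomputable def nextHill (r : ℝ → ℝ) (x : ℝ) : ℝ := sInf {a | x ≤ a ∧ IsHillAge r a}

/-- A hill size is a size `x` with `y(x) = x = z(x)`. -/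
def IsHillSize (r : ℝ → ℝ) (x : ℝ) : Prop := prevHill r x = x ∧ nextHill r x = x

/-- SERPT rank function: `r_S(a) = (∫_a^∞ F̄)/F̄(a)`. -/
noncomputable def serptRank (F : ℝ → ℝ) (a : ℝ) : ℝ := (∫ t in Ioi a, F t) / F a

/-- Truncated load complement `h(a) = 1 − λ∫₀^a F̄` (restricted to real ages). -/
noncomputable def loadComp (F : ℝ → ℝ) (lam : ℝ) (a : ℝ) : ℝ :=
  1 - lam * ∫ t in (0:ℝ)..a, F t

/-- Truncated load complement `h(a) = 1 − λ∫₀^a F̄`, with `h(∞) = 1 − ρ`. -/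
noncomputable def loadCompT (F : ℝ → ℝ) (lam : ℝ) : WithTop ℝ → ℝ :=
  WithTop.recTopCoe (1 - lam * ∫ t in Ioi (0:ℝ), F t)
    (fun a => 1 - lam * ∫ t in (0:ℝ)..a, F t)

/-- Truncated second-moment factor `J(a) = λ∫₀^a t·F̄(t) dt`, with
`J(∞) = λ∫₀^∞ t·F̄(t) dt = (λ/2)E[X²]`. -/
noncomputable def secMomT (F : ℝ → ℝ) (lam : ℝ) : WithTop ℝ → ℝ :=
  WithTop.recTopCoe (lam * ∫ t in Ioi (0:ℝ), t * F t)
    (fun a => lam * ∫ t in (0:ℝ)..a, t * F t)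

/-- A function `g : ℝ → ℝ` is piecewise monotonic: every compact interval admits a
finite partition on whose pieces `g` is monotone. -/
def PiecewiseMonotone (g : ℝ → ℝ) : Prop :=
  ∀ a b : ℝ, a ≤ b → ∃ (n : ℕ) (p : ℕ → ℝ), p 0 = a ∧ p n = b ∧
    (∀ i < n, p i ≤ p (i + 1)) ∧
    ∀ i < n, MonotoneOn g (Icc (p i) (p (i + 1))) ∨ AntitoneOn g (Icc (p i) (p (i + 1)))

/-- The interval `(u, v]` decomposes into finitely many hills and valleys of `r`. -/
def FiniteHillValleyDecomp (r : ℝ → ℝ) (u v : ℝ) : Prop :=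
  ∃ (n : ℕ) (p : ℕ → ℝ), p 0 = u ∧ p n = v ∧
    (∀ i ≤ n, IsHillAge r (p i)) ∧ (∀ i < n, p i < p (i + 1)) ∧
    ∀ i < n, (∀ x ∈ Ioc (p i) (p (i + 1)), IsHillSize r x) ∨
             (∀ x ∈ Ioo (p i) (p (i + 1)), ¬ IsHillSize r x)

/-- `[0,∞)` decomposes into a locally finite collection of hills and valleys of `r`. -/
def LocFinHillValleyDecomp (r : ℝ → ℝ) : Prop :=
  (∀ b : ℝ, ∃ v, b ≤ v ∧ FiniteHillValleyDecomp r 0 v) ∨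
  (∃ v, 0 ≤ v ∧ FiniteHillValleyDecomp r 0 v ∧ ∀ x, v < x → ¬ IsHillAge r x)

/-- For an increasing weight `α` and an increasing `K`, a bound that holds on every single interval
`(u, v]` (with `α` frozen at `u` and `K` at `v`) extends to the integral in which `α` and `K` are
evaluated at the previous and the next point of a closed set `H`. -/
theorem integral_le_of_forall_interval_le {H : Set ℝ} (hHc : IsClosed H) {T : ℝ} (hT : 0 ≤ T)
    (h0H : (0 : ℝ) ∈ H) (hTH : T ∈ H) {α K f φ : ℝ → ℝ}
    (hα : Continuous α) (hαm : Monotone α) (hα0 : ∀ x, 0 ≤ α x)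
    (hK : Continuous K) (hK0 : ∀ x, 0 ≤ x → 0 ≤ K x)
    (hf : Continuous f) (hf0 : ∀ x, 0 ≤ f x) (hφ : Continuous φ)
    (hcell : ∀ u v, 0 ≤ u → u ≤ v → ∫ x in u..v, (x - K v) * α u * f x ≤ φ v - φ u)
    (hint : IntegrableOn
      (fun x => (x - K (sInf {a | x ≤ a ∧ a ∈ H})) * α (sSup {a | a < x ∧ a ∈ H}) * f x)
      (Ioc 0 T)) :
    ∫ x in (0 : ℝ)..T,
      (x - K (sInf {a | x ≤ a ∧ a ∈ H})) * α (sSup {a | a < x ∧ a ∈ H}) * f x ≤ φ T - φ 0 := by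
  set Y : ℝ → ℝ := fun x => sSup {a | a < x ∧ a ∈ H} with hY
  set Z : ℝ → ℝ := fun x => sInf {a | x ≤ a ∧ a ∈ H} with hZ
  change ∫ x in (0 : ℝ)..T, (x - K (Z x)) * α (Y x) * f x ≤ φ T - φ 0
  set ψ : ℝ → ℝ := fun x => (x - K (Z x)) * α (Y x) * f x with hψ
  have hYlow : ∀ u x, u ∈ H → u < x → u ≤ Y x := fun u x hu hx =>
    le_csSup ⟨x, fun a ha => ha.1.le⟩ ⟨hx, hu⟩
  have hYup : ∀ u x b, u ∈ H → u < x → (∀ a ∈ H, a < x → a ≤ b) → Y x ≤ b := fun u x b hu hx hb =>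
    csSup_le ⟨u, hx, hu⟩ fun a ha => hb a ha.2 ha.1
  have hZup : ∀ v x, v ∈ H → x ≤ v → Z x ≤ v := fun v x hv hx =>
    csInf_le ⟨x, fun a ha => ha.1⟩ ⟨hx, hv⟩
  have hZlow : ∀ v x b, v ∈ H → x ≤ v → (∀ a ∈ H, x ≤ a → b ≤ a) → b ≤ Z x := fun v x b hv hx hb =>
    le_csInf ⟨v, hx, hv⟩ fun a ha => hb a ha.2 ha.1
  have hii : ∀ u v, 0 ≤ u → u ≤ v → v ≤ T → IntervalIntegrable ψ volume u v := by
    intro u v hu huv hv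
    rw [intervalIntegrable_iff_integrableOn_Ioc_of_le huv]
    exact hint.mono_set (Ioc_subset_Ioc hu hv)
  have hstep : ∀ u v E, 0 ≤ u → u ≤ v → v ≤ T →
      (∀ x ∈ Ioo u v, ψ x ≤ (x - K v) * α u * f x + E) →
      ∫ x in u..v, ψ x ≤ φ v - φ u + E * (v - u) := by
    intro u v E hu huv hv hle
    have hc : Continuous fun x => (x - K v) * α u * f x := by fun_prop
    have h1 := intervalIntegral.integral_mono_on_of_le_Ioo huv (hii u v hu huv hv)
      ((by fun_prop : Continuous fun x => (x - K v) * α u * f x + E).intervalIntegrable u v) hle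
    rw [intervalIntegral.integral_add (hc.intervalIntegrable u v) (by simp)] at h1
    have h2 := hcell u v hu huv
    simp only [intervalIntegral.integral_const, smul_eq_mul] at h1
    linarith
  have main : ∀ ε > 0, ∫ x in (0 : ℝ)..T, ψ x ≤ φ T - φ 0 + ε * T := by
    intro ε hε
    obtain ⟨M, hM⟩ := isCompact_Icc.bddAbove_image (hf.continuousOn (s := Icc 0 T))
    have hM' : ∀ x ∈ Icc 0 T, f x ≤ M := fun x hx => hM ⟨x, hx, rfl⟩
    have hM0 : 0 ≤ M := (hf0 0).trans (hM' 0 ⟨le_rfl, hT⟩)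
    have hN : 0 < M * (T + α T) + 1 := by have := hα0 T; positivity
    set η := ε / (M * (T + α T) + 1) with hη
    have hη0 : 0 < η := by positivity
    have hηε : η * (M * (T + α T)) ≤ ε := by
      have : η * (M * (T + α T) + 1) = ε := by rw [hη]; field_simp
      linarith
    obtain ⟨δ₁, hδ₁, hα'⟩ := Metric.uniformContinuousOn_iff.1
      (isCompact_Icc.uniformContinuousOn_of_continuous (hα.continuousOn (s := Icc 0 T))) η hη0
    obtain ⟨δ₂, hδ₂, hK'⟩ := Metric.uniformContinuousOn_iff.1
      (isCompact_Icc.uniformContinuousOn_of_continuous (hK.continuousOn (s := Icc 0 T))) η hη0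
    obtain ⟨δ, hδ, hδ1, hδ2⟩ : ∃ δ > 0, δ < δ₁ ∧ δ < δ₂ :=
      ⟨min δ₁ δ₂ / 2, by positivity, by
        have := min_le_left δ₁ δ₂; linarith [lt_min hδ₁ hδ₂], by
        have := min_le_right δ₁ δ₂; linarith [lt_min hδ₁ hδ₂]⟩
    set S : Set ℝ := {t | t ∈ H ∩ Icc 0 T ∧ ∫ x in (0 : ℝ)..t, ψ x ≤ φ t - φ 0 + ε * t} with hS
    have hext : ∀ u v, u ∈ S → v ∈ H → u ≤ v → v ≤ T →
        (∀ x ∈ Ioo u v, ψ x ≤ (x - K v) * α u * f x + ε) → v ∈ S := by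
      rintro u v ⟨⟨huH, hu0, huT⟩, hu⟩ hv huv hvT hle
      refine ⟨⟨hv, hu0.trans huv, hvT⟩, ?_⟩
      have := hstep u v ε hu0 huv hvT hle
      rw [← intervalIntegral.integral_add_adjacent_intervals (hii 0 u le_rfl hu0 huT)
        (hii u v hu0 huv hvT)]
      linarith
    have hSc : IsClosed S := by
      have hcont : ContinuousOn (fun t => ∫ x in (0 : ℝ)..t, ψ x) (Icc 0 T) := by
        have := intervalIntegral.continuousOn_primitive_interval' (hii 0 T le_rfl hT le_rfl)
          (left_mem_uIcc)
        rwa [uIcc_of_le hT] at this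
      have hcl := (hcont.prodMk (f := fun t => ∫ x in (0 : ℝ)..t, ψ x)
        (g := fun t => φ t - φ 0 + ε * t) (by fun_prop)).preimage_isClosed_of_isClosed
        isClosed_Icc OrderClosedTopology.isClosed_le'
      have : S = H ∩ (Icc 0 T ∩ (fun t => (∫ x in (0 : ℝ)..t, ψ x, φ t - φ 0 + ε * t)) ⁻¹'
          {p : ℝ × ℝ | p.1 ≤ p.2}) := by
        ext t
        simp only [hS, mem_ofPred_eq, mem_inter_iff, mem_preimage]
        tauto
      rw [this]
      exact hHc.inter hcl
    have hS0 : (0 : ℝ) ∈ S := ⟨⟨h0H, le_rfl, hT⟩, by simp⟩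
    have hSb : BddAbove S := ⟨T, fun t ht => ht.1.2.2⟩
    have hsS : sSup S ∈ S := hSc.csSup_mem ⟨0, hS0⟩ hSb
    set s := sSup S with hs
    have hs0 : 0 ≤ s := hsS.1.2.1
    have hmax : ∀ t ∈ S, t ≤ s := fun t ht => le_csSup hSb ht
    rcases hsS.1.2.2.eq_or_lt with hsT | hsT
    · rw [← hsT]; exact hsS.2
    exfalso
    by_cases hex : ∃ v ∈ H, s < v ∧ v ≤ T ∧ v ≤ s + δ
    · obtain ⟨v, hvH, hsv, hvT, hvδ⟩ := hex
      refine (hmax v (hext s v hsS hvH hsv.le hvT ?_)).not_gt hsv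
      rintro x ⟨hsx, hxv⟩
      have a1 := hYlow s x hsS.1.1 hsx
      have a2 := hYup s x x hsS.1.1 hsx fun a _ ha => ha.le
      have a3 := hZlow v x x hvH hxv.le fun a _ ha => ha
      have a4 := hZup v x hvH hxv.le
      have b1 := hα' (Y x) ⟨by linarith, by linarith⟩ s ⟨hs0, hsT.le⟩ (by
        rw [Real.dist_eq, abs_lt]; constructor <;> linarith)
      have b2 := hK' (Z x) ⟨by linarith, by linarith⟩ v ⟨by linarith, hvT⟩ (by
        rw [Real.dist_eq, abs_lt]; constructor <;> linarith)
      rw [Real.dist_eq, abs_lt] at b1 b2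
      have c1 := hαm a1
      have c2 := hK0 (Z x) (by linarith)
      have c3 := hα0 s
      have c4 := hαm hsT.le
      have c5 := hf0 x
      have c6 := hM' x ⟨by linarith, by linarith⟩
      have e1 : (x - K (Z x)) * α (Y x) ≤ (x - K v) * α s + η * (T + α T) := by
        nlinarith [mul_nonneg c2 (sub_nonneg.2 c1),
          mul_nonneg (show 0 ≤ x by linarith) (sub_nonneg.2 b1.2.le),
          mul_nonneg hη0.le (show 0 ≤ T - x by linarith),
          mul_nonneg hη0.le (sub_nonneg.2 c4),
          mul_nonneg c3 (show 0 ≤ K (Z x) - K v + η by linarith)]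
      have e2 := mul_le_mul_of_nonneg_right e1 c5
      have e3 : η * (T + α T) * f x ≤ η * (T + α T) * M :=
        mul_le_mul_of_nonneg_left c6 (mul_nonneg hη0.le (add_nonneg hT (hα0 T)))
      simp only [hψ]
      linarith
    · push Not at hex
      set m := min T (s + δ) with hm
      have hsm : s < m := lt_min hsT (by linarith)
      have hmem : sInf (H ∩ Ici m) ∈ H ∩ Ici m :=
        (hHc.inter isClosed_Ici).csInf_mem ⟨T, hTH, mem_Ici.2 (min_le_left _ _)⟩ ⟨m, fun a ha => ha.2⟩
      have hlow : ∀ a ∈ H, m ≤ a → sInf (H ∩ Ici m) ≤ a := fun a ha hma =>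
        csInf_le ⟨m, fun a ha => ha.2⟩ ⟨ha, hma⟩
      set v := sInf (H ∩ Ici m) with hv
      have hvm : m ≤ v := hmem.2
      have hvT : v ≤ T := hlow T hTH (min_le_left _ _)
      have hgap : ∀ a ∈ H, s < a → v ≤ a := by
        intro a ha hsa
        refine hlow a ha ?_
        by_contra! hlt
        have := hex a ha hsa (hlt.le.trans (min_le_left _ _))
        linarith [min_le_right T (s + δ)]
      refine (hmax v (hext s v hsS hmem.1 (by linarith) hvT ?_)).not_gt (by linarith)
      rintro x ⟨hsx, hxv⟩
      have hYx : Y x = s := le_antisymm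
        (hYup s x s hsS.1.1 hsx fun a ha hax => by
          by_contra! hlt
          linarith [hgap a ha hlt]) (hYlow s x hsS.1.1 hsx)
      have hZx : Z x = v := le_antisymm (hZup v x hmem.1 hxv.le)
        (hZlow v x v hmem.1 hxv.le fun a ha hxa => hgap a ha (by linarith))
      simp only [hψ, hYx, hZx]
      linarith
  refine le_of_forall_pos_le_add fun ε hε => ?_
  have h1 := main (ε / (T + 1)) (by positivity)
  have h2 : ε / (T + 1) * T ≤ ε := by
    rw [div_mul_eq_mul_div, div_le_iff₀ (by positivity)]
    nlinarith
  linarith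

/-- The truncated second-moment factor at real ages. -/
noncomputable def secMom (F : ℝ → ℝ) (lam a : ℝ) : ℝ := lam * ∫ t in (0:ℝ)..a, t * F t

/-- The potential whose increments bound the contribution of every hill or valley. -/
noncomputable def hillPotential (F : ℝ → ℝ) (lam a : ℝ) : ℝ :=
  -(1 / lam * Real.log (loadComp F lam a)) -
    (a * F a / loadComp F lam a - F a * secMom F lam a / loadComp F lam a ^ 2)

theorem add_sq_div_two_le_neg_log_one_sub {r : ℝ} (h0 : 0 ≤ r) (h1 : r < 1) :
    r + r ^ 2 / 2 ≤ -Real.log (1 - r) := by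
  have := sum_le_hasSum (Finset.range 2) (fun i _ => by positivity)
    (Real.hasSum_pow_div_log_of_abs_lt_one (abs_lt.2 ⟨by linarith, h1⟩))
  norm_num [Finset.sum_range_succ] at this
  linarith

/-- The algebraic core of the estimate on a single valley `(u, v]`, where `I = ∫ F`,
`p = F v ≤ q = F u`, and `Ju`, `Jv`, `hu`, `hv` are the values of the second-moment factor and
of the load complement at the endpoints. -/
theorem valley_algebra {lam u v I p q Ju Jv hu hv : ℝ} (hlam : 0 < lam) (hu0 : 0 ≤ u)
    (hI : 0 ≤ I) (hp : 0 ≤ p) (hpq : p ≤ q) (hJu : 0 ≤ Ju) (hv0 : 0 < hv)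
    (hhv : hv = hu - lam * I) (hJv : Ju + lam * (u * I + p * (v - u) ^ 2 / 2) ≤ Jv) :
    ((u - Jv / hv) * q - (v - Jv / hv) * p + I) / hu ≤
      1 / lam * Real.log (hu / hv) + (u * q / hu - q * Ju / hu ^ 2) -
        (v * p / hv - p * Jv / hv ^ 2) := by
  have hlI : 0 ≤ lam * I := by positivity
  have hhu : hv ≤ hu := by linarith
  have hu0' : 0 < hu := by linarith
  have hlog : I / hu + lam * I ^ 2 / (2 * hu ^ 2) ≤ 1 / lam * Real.log (hu / hv) := by
    have h := add_sq_div_two_le_neg_log_one_sub (r := lam * I / hu) (by positivity)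
      ((div_lt_one hu0').2 (by linarith))
    have e : 1 - lam * I / hu = (hu / hv)⁻¹ := by rw [hhv]; field_simp
    rw [e, Real.log_inv, neg_neg] at h
    calc I / hu + lam * I ^ 2 / (2 * hu ^ 2)
        = 1 / lam * (lam * I / hu + (lam * I / hu) ^ 2 / 2) := by field_simp
      _ ≤ _ := by gcongr
  have hJle : Ju ≤ Jv := by
    have : 0 ≤ lam * (u * I + p * (v - u) ^ 2 / 2) := by positivity
    linarith
  set a := 1 / hu with ha
  set b := 1 / hv with hb
  have ha0 : 0 < a := by positivity
  have hab : a ≤ b := one_div_le_one_div_of_le hv0 hhu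
  have hba : b - a = lam * I * a * b := by
    rw [ha, hb, hhv]
    rw [hhv] at hv0
    field_simp
    ring
  have hq : 0 ≤ (q - p) * (Jv * b - Ju * a) * a := by
    have : Ju * a ≤ Jv * b := mul_le_mul hJle hab ha0.le (hJu.trans hJle)
    have := sub_nonneg.2 this
    have := sub_nonneg.2 hpq
    positivity
  have hJ : 0 ≤ p * b ^ 2 * (Jv - (Ju + lam * (u * I + p * (v - u) ^ 2 / 2))) :=
    mul_nonneg (by positivity) (by linarith)
  have hJu2 : 0 ≤ p * Ju * (b ^ 2 - a ^ 2) :=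
    mul_nonneg (by positivity) (sub_nonneg.2 (pow_le_pow_left₀ ha0.le hab 2))
  have hui : 0 ≤ p * lam * u * I * b * (b - a) :=
    mul_nonneg (by have := ha0.trans_le hab; positivity) (sub_nonneg.2 hab)
  have hsq : 0 ≤ lam / 2 * (I * a - p * (v - u) * b) ^ 2 := by positivity
  have key : ((u - Jv * b) * q - (v - Jv * b) * p + I) * a ≤
      (I * a + lam * I ^ 2 * a ^ 2 / 2) + (u * q * a - q * Ju * a ^ 2) -
        (v * p * b - p * Jv * b ^ 2) := by
    have e : v * p * b = v * p * a + v * p * (lam * I * a * b) := by rw [← hba]; ring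
    rw [e]
    nlinarith
  have e1 : ((u - Jv / hv) * q - (v - Jv / hv) * p + I) / hu =
      ((u - Jv * b) * q - (v - Jv * b) * p + I) * a := by rw [ha, hb]; ring
  have e2 : (u * q / hu - q * Ju / hu ^ 2) - (v * p / hv - p * Jv / hv ^ 2) =
      (u * q * a - q * Ju * a ^ 2) - (v * p * b - p * Jv * b ^ 2) := by rw [ha, hb]; ring
  have e3 : I / hu + lam * I ^ 2 / (2 * hu ^ 2) = I * a + lam * I ^ 2 * a ^ 2 / 2 := by
    rw [ha]; field_simp
  linarith

section tail

variable {F : ℝ → ℝ} {lam : ℝ}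

theorem continuous_loadComp (hF : Continuous F) : Continuous (loadComp F lam) := by
  unfold loadComp
  exact continuous_const.sub (continuous_const.mul
    (intervalIntegral.continuous_primitive (fun a b => hF.intervalIntegrable a b) 0))

theorem continuous_secMom (hF : Continuous F) : Continuous (secMom F lam) := by
  unfold secMom
  exact continuous_const.mul (intervalIntegral.continuous_primitive
    (fun a b => (continuous_id.mul hF).intervalIntegrable a b) 0)

theorem loadComp_sub (hF : Continuous F) (u v : ℝ) :
    loadComp F lam v = loadComp F lam u - lam * ∫ t in u..v, F t := by
  unfold loadComp
  rw [← intervalIntegral.integral_add_adjacent_intervals (hF.intervalIntegrable 0 u)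
    (hF.intervalIntegrable u v)]
  ring

theorem secMom_add (hF : Continuous F) (u v : ℝ) :
    secMom F lam v = secMom F lam u + lam * ∫ t in u..v, t * F t := by
  unfold secMom
  have hc : Continuous fun t => t * F t := by fun_prop
  rw [← intervalIntegral.integral_add_adjacent_intervals (hc.intervalIntegrable 0 u)
    (hc.intervalIntegrable u v)]
  ring

theorem antitone_loadComp (hF : Continuous F) (hF0 : ∀ t, 0 ≤ F t) (hlam : 0 < lam) :
    Antitone (loadComp F lam) := by
  intro u v huv
  rw [loadComp_sub hF u v]
  have := intervalIntegral.integral_nonneg_of_forall huv hF0 (μ := volume)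
  nlinarith

theorem one_sub_load_le_loadComp (hF : Continuous F) (hF0 : ∀ t, 0 ≤ F t)
    (hFi : IntegrableOn F (Ioi 0)) (hlam : 0 < lam) (a : ℝ) :
    1 - lam * ∫ t in Ioi (0:ℝ), F t ≤ loadComp F lam a := by
  refine (antitone_loadComp hF hF0 hlam).le_of_tendsto (Filter.Tendsto.const_sub _ ?_) a
  exact (intervalIntegral_tendsto_integral_Ioi 0 hFi Filter.tendsto_id).const_mul lam

theorem monotoneOn_secMom (hF : Continuous F) (hF0 : ∀ t, 0 ≤ F t) (hlam : 0 < lam) :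
    MonotoneOn (secMom F lam) (Ici 0) := by
  intro u hu v hv huv
  rw [secMom_add hF u v]
  have : 0 ≤ ∫ t in u..v, t * F t := intervalIntegral.integral_nonneg huv fun t ht =>
    mul_nonneg (le_trans hu ht.1) (hF0 t)
  nlinarith

theorem secMom_nonneg (hF : Continuous F) (hF0 : ∀ t, 0 ≤ F t) (hlam : 0 < lam) {a : ℝ}
    (ha : 0 ≤ a) : 0 ≤ secMom F lam a := by
  have := monotoneOn_secMom hF hF0 hlam self_mem_Ici ha ha
  simpa [secMom] using this

theorem integral_sub_mul_neg_deriv (hF : ContDiff ℝ 1 F) (u v k : ℝ) :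
    ∫ x in u..v, (x - k) * -deriv F x = (u - k) * F u - (v - k) * F v + ∫ x in u..v, F x := by
  have hc := hF.continuous
  have hd := hF.continuous_deriv le_rfl
  have h := intervalIntegral.integral_eq_sub_of_hasDerivAt (a := u) (b := v)
    (f := fun x => (x - k) * F x) (f' := fun x => 1 * F x + (x - k) * deriv F x)
    (fun x _ => ((hasDerivAt_id x).sub_const k).mul
      (hF.differentiable one_ne_zero x).hasDerivAt)
    (Continuous.intervalIntegrable (by fun_prop) u v)
  rw [intervalIntegral.integral_add (Continuous.intervalIntegrable (by fun_prop) u v)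
    (Continuous.intervalIntegrable (by fun_prop) u v)] at h
  simp only [one_mul] at h
  simp only [mul_neg, intervalIntegral.integral_neg]
  linarith

theorem integral_valley_le (hF : ContDiff ℝ 1 F) (hFa : Antitone F) (hF0 : ∀ t, 0 ≤ F t)
    (hlam : 0 < lam) (hpos : ∀ a, 0 < loadComp F lam a) {u v : ℝ} (hu : 0 ≤ u) (huv : u ≤ v) :
    ∫ x in u..v, (x - secMom F lam v / loadComp F lam v) * (loadComp F lam u)⁻¹ * -deriv F x ≤
      hillPotential F lam v - hillPotential F lam u := by
  have hc := hF.continuous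
  have hsec : secMom F lam u + lam * (u * (∫ x in u..v, F x) + F v * (v - u) ^ 2 / 2) ≤
      secMom F lam v := by
    rw [secMom_add hc u v]
    have e : u * (∫ x in u..v, F x) + F v * (v - u) ^ 2 / 2 =
        ∫ x in u..v, (u * F x + F v * (x - u)) := by
      rw [intervalIntegral.integral_add (Continuous.intervalIntegrable (by fun_prop) u v)
        (Continuous.intervalIntegrable (by fun_prop) u v), intervalIntegral.integral_const_mul,
        intervalIntegral.integral_const_mul, intervalIntegral.integral_sub (by simp) (by simp),
        integral_id, intervalIntegral.integral_const, smul_eq_mul]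
      ring
    rw [e]
    gcongr
    refine intervalIntegral.integral_mono_on huv (Continuous.intervalIntegrable (by fun_prop) u v)
      (Continuous.intervalIntegrable (by fun_prop) u v) fun x hx => ?_
    nlinarith [mul_nonneg (sub_nonneg.2 hx.1) (sub_nonneg.2 (hFa hx.2))]
  have key := valley_algebra (q := F u) hlam hu
    (intervalIntegral.integral_nonneg_of_forall huv hF0 (μ := volume)) (hF0 v) (hFa huv)
    (secMom_nonneg hc hF0 hlam hu) (hpos v) (loadComp_sub hc u v) hsec
  have e : ∫ x in u..v,
      (x - secMom F lam v / loadComp F lam v) * (loadComp F lam u)⁻¹ * -deriv F x =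
      (∫ x in u..v, (x - secMom F lam v / loadComp F lam v) * -deriv F x) / loadComp F lam u := by
    rw [← intervalIntegral.integral_div]
    congr 1
    ext x
    ring
  rw [e, integral_sub_mul_neg_deriv hF]
  rw [Real.log_div (hpos u).ne' (hpos v).ne'] at key
  unfold hillPotential
  linarith

theorem continuous_hillPotential (hF : Continuous F) (hpos : ∀ a, 0 < loadComp F lam a) :
    Continuous (hillPotential F lam) := by
  have h1 := continuous_loadComp (lam := lam) hF
  have h2 := continuous_secMom (lam := lam) hF
  unfold hillPotential
  have h3 := fun a => (hpos a).ne'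
  have h4 := h1.log h3
  have h5 := (continuous_id.mul hF).div h1 h3
  have h6 := (hF.mul h2).div (h1.pow 2) fun a => pow_ne_zero 2 (h3 a)
  exact (continuous_const.mul h4).neg.sub (h5.sub h6)

theorem hillPotential_zero : hillPotential F lam 0 = 0 := by
  simp [hillPotential, loadComp, secMom]

end tail

theorem isClosed_setOf_isHillAge (r : ℝ → ℝ) : IsClosed {a | IsHillAge r a} := by
  have : {a | IsHillAge r a} = Ici 0 ∩ {a | IsValleyAge r a}ᶜ := by
    ext a
    simp [IsHillAge]
  rw [this]
  refine isClosed_Ici.inter (IsOpen.isClosed_compl ?_)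
  rw [Metric.isOpen_iff]
  rintro a ⟨ha, ε, hε, h⟩
  refine ⟨min a (ε / 2), by positivity, fun b hb => ?_⟩
  rw [Metric.mem_ball, Real.dist_eq, lt_min_iff, abs_lt, abs_lt] at hb
  refine ⟨by linarith, ε / 2, by positivity, fun c hc => ?_⟩
  rw [h c ⟨by linarith [hc.1], by linarith [hc.2]⟩, h b ⟨by linarith, by linarith⟩]

theorem isHillAge_zero (r : ℝ → ℝ) : IsHillAge r 0 := ⟨le_rfl, fun h => lt_irrefl _ h.1⟩

theorem incEnvelope_eq_of_no_hill {r : ℝ → ℝ} {x a : ℝ} (hx : 0 ≤ x)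
    (h : ∀ a, x ≤ a → ¬ IsHillAge r a) (hxa : x ≤ a) : incEnvelope r a = incEnvelope r x := by
  have hloc : ∀ b, x ≤ b → incEnvelope r =ᶠ[nhds b] fun _ => incEnvelope r b := by
    intro b hb
    have hv : IsValleyAge r b := by
      by_contra hn
      exact h b hb ⟨hx.trans hb, hn⟩
    obtain ⟨-, ε, hε, hc⟩ := hv
    filter_upwards [Ioo_mem_nhds (sub_lt_self b hε) (lt_add_of_pos_right b hε)] with c hcm
    exact hc c hcm
  have hd : ∀ b, x ≤ b → HasDerivAt (incEnvelope r) 0 b := fun b hb =>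
    (hasDerivAt_const b (incEnvelope r b)).congr_of_eventuallyEq (hloc b hb)
  exact constant_of_has_deriv_right_zero
    (fun b hb => (hd b hb.1).continuousAt.continuousWithinAt)
    (fun b hb => (hd b hb.1).hasDerivWithinAt) a ⟨hxa, le_rfl⟩

section tail

variable {F : ℝ → ℝ}

theorem setIntegral_Ioi_eq_zero (hFa : Antitone F) (hF0 : ∀ t, 0 ≤ F t) {a : ℝ} (ha : F a = 0) :
    ∫ t in Ioi a, F t = 0 :=
  setIntegral_eq_zero_of_forall_eq_zero fun t ht =>
    le_antisymm ((hFa (le_of_lt ht)).trans ha.le) (hF0 t)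

theorem serptRank_mul_eq (hFa : Antitone F) (hF0 : ∀ t, 0 ≤ F t) (a : ℝ) :
    serptRank F a * F a = ∫ t in Ioi a, F t := by
  by_cases ha : F a = 0
  · rw [ha, mul_zero, setIntegral_Ioi_eq_zero hFa hF0 ha]
  · exact div_mul_cancel₀ _ ha

theorem serptRank_nonneg (hF0 : ∀ t, 0 ≤ F t) (a : ℝ) : 0 ≤ serptRank F a :=
  div_nonneg (integral_nonneg hF0) (hF0 a)

theorem serptRank_le_incEnvelope (hF : Continuous F) (hFa : Antitone F) (hF0 : ∀ t, 0 ≤ F t)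
    (hFi : IntegrableOn F (Ioi 0)) {a : ℝ} (ha : 0 ≤ a) :
    serptRank F a ≤ incEnvelope (serptRank F) a := by
  refine le_csSup ⟨a + serptRank F a, ?_⟩ ⟨a, ⟨ha, le_rfl⟩, rfl⟩
  rintro _ ⟨b, ⟨hb, hba⟩, rfl⟩
  rcases (hF0 b).eq_or_lt with h | h
  · have := serptRank_nonneg hF0 a
    simp only [serptRank, ← h, div_zero] at this ⊢
    linarith
  · rw [serptRank, div_le_iff₀ h, ← intervalIntegral.integral_interval_add_Ioi
      (hFi.mono_set (Ioi_subset_Ioi hb)) (hFi.mono_set (Ioi_subset_Ioi ha)),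
      ← serptRank_mul_eq hFa hF0 a]
    have h1 : ∫ t in b..a, F t ≤ ∫ _ in b..a, F b :=
      intervalIntegral.integral_mono_on hba (hF.intervalIntegrable b a) (by simp)
        fun t ht => hFa ht.1
    rw [intervalIntegral.integral_const, smul_eq_mul] at h1
    nlinarith [mul_nonneg (serptRank_nonneg hF0 a) (sub_nonneg.2 (hFa hba)), mul_nonneg hb h.le]

theorem integrableOn_mul_of_no_hill (hF : Continuous F) (hFa : Antitone F) (hF0 : ∀ t, 0 ≤ F t)
    (hFi : IntegrableOn F (Ioi 0)) {x : ℝ} (hx : 0 ≤ x)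
    (h : ∀ a, x ≤ a → ¬ IsHillAge (serptRank F) a) :
    IntegrableOn (fun t => t * F t) (Ioi 0) := by
  set M := incEnvelope (serptRank F) x with hM
  have hc : Continuous fun t => t * F t := by fun_prop
  set m := ∫ t in Ioi (0:ℝ), F t with hm
  set G : ℝ → ℝ := fun t => m - ∫ s in (0:ℝ)..t, F s with hG
  have hGc : Continuous G := continuous_const.sub
    (intervalIntegral.continuous_primitive (fun a b => hF.intervalIntegrable a b) 0)
  have hGd : ∀ t, HasDerivAt G (-F t) t := fun t =>
    ((hF.integral_hasStrictDerivAt 0 t).hasDerivAt).const_sub m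
  have hGI : ∀ t, 0 ≤ t → G t = ∫ s in Ioi t, F s := by
    intro t ht
    simp only [hG, hm]
    rw [← intervalIntegral.integral_interval_add_Ioi hFi (hFi.mono_set (Ioi_subset_Ioi ht))]
    ring
  have hG0 : ∀ t, 0 ≤ t → 0 ≤ G t := fun t ht => by
    rw [hGI t ht]
    exact integral_nonneg hF0
  have hGM : ∀ t, x ≤ t → G t ≤ M * F t := by
    intro t ht
    rw [hGI t (hx.trans ht), ← serptRank_mul_eq hFa hF0]
    refine mul_le_mul_of_nonneg_right ?_ (hF0 t)
    rw [hM, ← incEnvelope_eq_of_no_hill hx h ht]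
    exact serptRank_le_incEnvelope hF hFa hF0 hFi (hx.trans ht)
  have hM0 : 0 ≤ M := (serptRank_nonneg hF0 x).trans (serptRank_le_incEnvelope hF hFa hF0 hFi hx)
  rw [← Ioc_union_Ioi_eq_Ioi hx]
  refine (hc.integrableOn_Ioc).union (integrableOn_Ioi_of_intervalIntegral_norm_bounded
    (l := Filter.atTop) (b := id) (x * G x + M * G x) x (fun i => hc.integrableOn_Ioc)
    Filter.tendsto_id ?_)
  filter_upwards [Filter.eventually_ge_atTop x] with b hb
  have e1 : ∫ t in x..b, ‖t * F t‖ = ∫ t in x..b, t * F t := by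
    refine intervalIntegral.integral_congr fun t ht => ?_
    rw [uIcc_of_le hb] at ht
    exact Real.norm_of_nonneg (mul_nonneg (hx.trans ht.1) (hF0 t))
  have e2 := intervalIntegral.integral_eq_sub_of_hasDerivAt (a := x) (b := b)
    (f := fun t => t * G t) (f' := fun t => 1 * G t + t * -F t)
    (fun t _ => (hasDerivAt_id t).mul (hGd t)) (Continuous.intervalIntegrable (by fun_prop) x b)
  rw [intervalIntegral.integral_add (Continuous.intervalIntegrable (by fun_prop) x b)
    (Continuous.intervalIntegrable (by fun_prop) x b)] at e2
  simp only [one_mul, mul_neg, intervalIntegral.integral_neg] at e2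
  have e3 : ∫ t in x..b, G t ≤ ∫ t in x..b, M * F t :=
    intervalIntegral.integral_mono_on hb (hGc.intervalIntegrable x b)
      (Continuous.intervalIntegrable (by fun_prop) x b) fun t ht => hGM t ht.1
  have e4 : ∫ t in x..b, M * F t = M * (G x - G b) := by
    rw [intervalIntegral.integral_const_mul]
    simp only [hG]
    rw [← intervalIntegral.integral_add_adjacent_intervals (hF.intervalIntegrable 0 x)
      (hF.intervalIntegrable x b)]
    ring
  have e5 := hG0 b (hx.trans hb)
  simp only [id]
  rw [e1]
  nlinarith [mul_nonneg hM0 e5, mul_nonneg (hx.trans hb) e5]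

theorem tendsto_mul_self_atTop_zero (hF : Continuous F) (hFa : Antitone F) (hF0 : ∀ t, 0 ≤ F t)
    (hFi : IntegrableOn F (Ioi 0)) :
    Filter.Tendsto (fun t => t * F t) Filter.atTop (nhds 0) := by
  have h1 := intervalIntegral_tendsto_integral_Ioi 0 hFi Filter.tendsto_id
  have h2 := intervalIntegral_tendsto_integral_Ioi 0 hFi
    (Filter.tendsto_id.atTop_div_const (two_pos : (0:ℝ) < 2))
  have h3 := (h1.sub h2).const_mul 2
  rw [sub_self, mul_zero] at h3
  refine squeeze_zero' ?_ ?_ h3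
  · filter_upwards [Filter.eventually_ge_atTop 0] with t ht using mul_nonneg ht (hF0 t)
  · filter_upwards [Filter.eventually_ge_atTop 0] with t ht
    simp only [id]
    rw [← intervalIntegral.integral_add_adjacent_intervals (hF.intervalIntegrable 0 (t / 2))
      (hF.intervalIntegrable (t / 2) t)]
    have h : ∫ _ in (t / 2)..t, F t ≤ ∫ s in (t / 2)..t, F s :=
      intervalIntegral.integral_mono_on (by linarith) (by simp) (hF.intervalIntegrable _ _)
        fun s hs => hFa hs.2
    rw [intervalIntegral.integral_const, smul_eq_mul] at h
    linarith

end tail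

theorem monotone_prevHill (r : ℝ → ℝ) : Monotone (prevHill r) := by
  intro x y hxy
  unfold prevHill
  rcases Set.eq_empty_or_nonempty {a | a < x ∧ IsHillAge r a} with h | h
  · rw [h, Real.sSup_empty]
    exact Real.sSup_nonneg fun a ha => ha.2.1
  · exact csSup_le_csSup ⟨y, fun a ha => ha.1.le⟩ h fun a ha => ⟨ha.1.trans_le hxy, ha.2⟩

theorem monotone_sInf_ge {H : Set ℝ} (hH : ∀ x, ∃ a, x ≤ a ∧ a ∈ H) :
    Monotone fun x => sInf {a | x ≤ a ∧ a ∈ H} := fun x y hxy =>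
  csInf_le_csInf ⟨x, fun _ ha => ha.1⟩ (hH y) fun _ ha => ⟨hxy.trans ha.1, ha.2⟩

section tail

variable {F : ℝ → ℝ} {lam : ℝ}

theorem secMom_div_loadComp_mono (hF : Continuous F) (hF0 : ∀ t, 0 ≤ F t) (hlam : 0 < lam)
    (hpos : ∀ a, 0 < loadComp F lam a) :
    MonotoneOn (fun a => secMom F lam a / loadComp F lam a) (Ici 0) := fun _ ha _ hb hab =>
  div_le_div₀ (secMom_nonneg hF hF0 hlam hb) (monotoneOn_secMom hF hF0 hlam ha hb hab) (hpos _)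
    (antitone_loadComp hF hF0 hlam hab)

/-- The ratio of second-moment factor and load complement at the next hill age dominates the one
at any real age below the next hill age. -/
theorem secMom_div_loadComp_le_nextHillT (hF : Continuous F) (hFa : Antitone F)
    (hF0 : ∀ t, 0 ≤ F t) (hFi : IntegrableOn F (Ioi 0)) (hlam : 0 < lam)
    (hc : 0 < 1 - lam * ∫ t in Ioi (0:ℝ), F t) {x z : ℝ} (hx : 0 ≤ x) (hz : 0 ≤ z)
    (hle : ∀ b, x ≤ b → IsHillAge (serptRank F) b →
      z ≤ sInf {a | x ≤ a ∧ IsHillAge (serptRank F) a}) :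
    secMom F lam z / loadComp F lam z ≤ secMomT F lam (nextHillT (serptRank F) x) /
      loadCompT F lam (nextHillT (serptRank F) x) := by
  have hpos := fun a => hc.trans_le (one_sub_load_le_loadComp hF hF0 hFi hlam a)
  unfold nextHillT
  split_ifs with hex
  · obtain ⟨b, hb, hbh⟩ := hex
    have h := hle b hb hbh
    exact secMom_div_loadComp_mono hF hF0 hlam hpos hz (hz.trans h) h
  · push Not at hex
    have hi := integrableOn_mul_of_no_hill hF hFa hF0 hFi hx hex
    change _ ≤ (lam * ∫ t in Ioi (0:ℝ), t * F t) / (1 - lam * ∫ t in Ioi (0:ℝ), F t)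
    have hJ : secMom F lam z ≤ lam * ∫ t in Ioi (0:ℝ), t * F t := by
      unfold secMom
      rw [intervalIntegral.integral_of_le hz]
      refine mul_le_mul_of_nonneg_left
        (setIntegral_mono_set hi ?_ Ioc_subset_Ioi_self.eventuallyLE) hlam.le
      exact (ae_restrict_iff' measurableSet_Ioi).2
        (Filter.Eventually.of_forall fun t ht => mul_nonneg (le_of_lt ht) (hF0 t))
    exact div_le_div₀ ((secMom_nonneg hF hF0 hlam hz).trans hJ) hJ hc
      (one_sub_load_le_loadComp hF hF0 hFi hlam z)

theorem hillPotential_le (hF : Continuous F) (hF0 : ∀ t, 0 ≤ F t)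
    (hFi : IntegrableOn F (Ioi 0)) (hlam : 0 < lam)
    (hc : 0 < 1 - lam * ∫ t in Ioi (0:ℝ), F t) {T : ℝ} (hT : 0 ≤ T) :
    hillPotential F lam T ≤ 1 / lam * Real.log (1 / (1 - lam * ∫ t in Ioi (0:ℝ), F t)) +
      T * F T / (1 - lam * ∫ t in Ioi (0:ℝ), F t) ^ 2 := by
  have hle := one_sub_load_le_loadComp hF hF0 hFi hlam T
  set c := 1 - lam * ∫ t in Ioi (0:ℝ), F t with hcdef
  have hpos := hc.trans_le hle
  have hlog : 1 / lam * Real.log c ≤ 1 / lam * Real.log (loadComp F lam T) := by gcongr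
  have h1 : 0 ≤ T * F T / loadComp F lam T := div_nonneg (mul_nonneg hT (hF0 T)) hpos.le
  have hJ : secMom F lam T ≤ T := by
    have h : ∫ t in (0:ℝ)..T, t * F t ≤ ∫ t in (0:ℝ)..T, T * F t :=
      intervalIntegral.integral_mono_on hT (Continuous.intervalIntegrable (by fun_prop) 0 T)
        (Continuous.intervalIntegrable (by fun_prop) 0 T)
        fun t ht => mul_le_mul_of_nonneg_right ht.2 (hF0 t)
    rw [intervalIntegral.integral_const_mul] at h
    have h' := mul_le_mul_of_nonneg_left h hlam.le
    unfold loadComp at hpos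
    unfold secMom
    nlinarith
  have h2 : F T * secMom F lam T / loadComp F lam T ^ 2 ≤ T * F T / c ^ 2 := by
    rw [mul_comm T]
    exact div_le_div₀ (mul_nonneg (hF0 T) hT) (mul_le_mul_of_nonneg_left hJ (hF0 T))
      (by positivity) (pow_le_pow_left₀ hc.le hle 2)
  rw [one_div c, Real.log_inv]
  unfold hillPotential
  linarith

theorem lintegral_Ioc_le (hF : ContDiff ℝ 1 F) (hFa : Antitone F)
    (hF0 : ∀ t, 0 ≤ F t) (hFi : IntegrableOn F (Ioi 0)) (hlam : 0 < lam)
    (hc : 0 < 1 - lam * ∫ t in Ioi (0:ℝ), F t) {T : ℝ} (hT : 0 ≤ T) :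
    (∫⁻ x in Ioc (0:ℝ) T,
        ENNReal.ofReal (x / loadComp F lam (prevHill (serptRank F) x) * (-deriv F x)))
      ≤ (∫⁻ x in Ioi (0:ℝ),
          ENNReal.ofReal
            (secMomT F lam (nextHillT (serptRank F) x) /
                (loadComp F lam (prevHill (serptRank F) x) *
                  loadCompT F lam (nextHillT (serptRank F) x)) *
              (-deriv F x)))
        + ENNReal.ofReal (hillPotential F lam T) := by
  have hFc := hF.continuous
  have hcle := one_sub_load_le_loadComp hFc hF0 hFi hlam
  have hpos := fun a => hc.trans_le (hcle a)
  set r := serptRank F with hr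
  set c := 1 - lam * ∫ t in Ioi (0:ℝ), F t with hcdef
  set H : Set ℝ := {a | IsHillAge r a} ∪ Ici T with hH
  set f : ℝ → ℝ := fun x => -deriv F x with hf
  set α : ℝ → ℝ := fun x => (loadComp F lam x)⁻¹ with hα
  set K : ℝ → ℝ := fun x => secMom F lam x / loadComp F lam x with hK
  set Z : ℝ → ℝ := fun x => sInf {a | x ≤ a ∧ a ∈ H} with hZ
  have hTH : T ∈ H := Or.inr self_mem_Ici
  have hhc := continuous_loadComp (lam := lam) hFc
  have hfc : Continuous f := (hF.continuous_deriv le_rfl).neg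
  have hf0 : ∀ x, 0 ≤ f x := fun x => neg_nonneg.2 hFa.deriv_nonpos
  have hαc : Continuous α := hhc.inv₀ fun a => (hpos a).ne'
  have hα0 : ∀ x, 0 ≤ α x := fun x => inv_nonneg.2 (hpos x).le
  have hαm : Monotone α := fun x y hxy =>
    inv_anti₀ (hpos y) (antitone_loadComp hFc hF0 hlam hxy)
  have hαle : ∀ x, α x ≤ c⁻¹ := fun x => inv_anti₀ hc (hcle x)
  have hKc : Continuous K := (continuous_secMom hFc).div hhc fun a => (hpos a).ne'
  have hKm : MonotoneOn K (Ici 0) := secMom_div_loadComp_mono hFc hF0 hlam hpos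
  have hK0 : ∀ x, 0 ≤ x → 0 ≤ K x := fun x hx =>
    div_nonneg (secMom_nonneg hFc hF0 hlam hx) (hpos x).le
  have hZm : Monotone Z := monotone_sInf_ge fun x =>
    ⟨max x T, le_max_left _ _, Or.inr (le_max_right x T)⟩
  have hYm := monotone_prevHill r
  have hZx : ∀ x ∈ Ioc 0 T, 0 ≤ Z x ∧ Z x ≤ T := fun x hx =>
    ⟨hx.1.le.trans (le_csInf ⟨T, hx.2, hTH⟩ fun a ha => ha.1),
      csInf_le ⟨x, fun a ha => ha.1⟩ ⟨hx.2, hTH⟩⟩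
  have hYx : ∀ x ∈ Ioc 0 T, sSup {a | a < x ∧ a ∈ H} = prevHill r x := by
    intro x hx
    unfold prevHill
    congr 1
    ext a
    constructor
    · rintro ⟨hax, ha | ha⟩
      · exact ⟨hax, ha⟩
      · exact absurd (hax.trans_le hx.2) (not_lt.2 ha)
    · exact fun ha => ⟨ha.1, Or.inl ha.2⟩
  obtain ⟨M, hM⟩ := isCompact_Icc.bddAbove_image (hfc.continuousOn (s := Icc 0 T))
  have hM' : ∀ x ∈ Ioc 0 T, f x ≤ M := fun x hx => hM ⟨x, Ioc_subset_Icc_self hx, rfl⟩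
  have hM0 : 0 ≤ M := (hf0 0).trans (hM ⟨0, ⟨le_rfl, hT⟩, rfl⟩)
  have hbdd : ∀ g : ℝ → ℝ, Measurable g → ∀ C, (∀ x ∈ Ioc 0 T, 0 ≤ g x ∧ g x ≤ C) →
      IntegrableOn (fun x => g x * α (prevHill r x) * f x) (Ioc 0 T) := by
    intro g hg C hgC
    have hmeas : Measurable fun x => g x * α (prevHill r x) * f x :=
      (hg.mul (hαc.measurable.comp hYm.measurable)).mul hfc.measurable
    refine Measure.integrableOn_of_bounded (M := C * c⁻¹ * M) measure_Ioc_lt_top.ne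
      hmeas.aestronglyMeasurable ?_
    refine (ae_restrict_iff' measurableSet_Ioc).2 (Filter.Eventually.of_forall fun x hx => ?_)
    obtain ⟨h1, h2⟩ := hgC x hx
    rw [Real.norm_of_nonneg (mul_nonneg (mul_nonneg h1 (hα0 _)) (hf0 x))]
    exact mul_le_mul (mul_le_mul h2 (hαle _) (hα0 _) (h1.trans h2)) (hM' x hx) (hf0 x)
      (mul_nonneg (h1.trans h2) (inv_nonneg.2 hc.le))
  have hA := hbdd (fun x => x) measurable_id T fun x hx => ⟨hx.1.le, hx.2⟩
  have hB := hbdd (fun x => K (Z x)) (hKc.measurable.comp hZm.measurable) (K T) fun x hx =>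
    ⟨hK0 _ (hZx x hx).1, hKm (hZx x hx).1 hT (hZx x hx).2⟩
  have hAB : ∀ x ∈ Ioc 0 T, x * α (prevHill r x) * f x - K (Z x) * α (prevHill r x) * f x =
      (x - K (Z x)) * α (sSup {a | a < x ∧ a ∈ H}) * f x := by
    intro x hx
    rw [hYx x hx]
    ring
  have key := integral_le_of_forall_interval_le
    ((isClosed_setOf_isHillAge r).union isClosed_Ici : IsClosed H) hT
    (Or.inl (isHillAge_zero r)) hTH hαc hαm hα0 hKc hK0 hfc hf0
    (continuous_hillPotential hFc hpos)
    (fun u v hu huv => integral_valley_le hF hFa hF0 hlam hpos hu huv)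
    ((hA.sub hB).congr_fun hAB measurableSet_Ioc)
  rw [intervalIntegral.integral_of_le hT, ← setIntegral_congr_fun measurableSet_Ioc hAB,
    integral_sub hA hB, hillPotential_zero, sub_zero] at key
  have hA' : ∫⁻ x in Ioc 0 T, ENNReal.ofReal (x / loadComp F lam (prevHill r x) * -deriv F x) =
      ENNReal.ofReal (∫ x in Ioc 0 T, x * α (prevHill r x) * f x) :=
    (ofReal_integral_eq_lintegral_ofReal hA ((ae_restrict_iff' measurableSet_Ioc).2
      (Filter.Eventually.of_forall fun x hx =>
        mul_nonneg (mul_nonneg hx.1.le (hα0 _)) (hf0 x)))).symm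
  rw [hA']
  calc ENNReal.ofReal (∫ x in Ioc 0 T, x * α (prevHill r x) * f x)
      ≤ ENNReal.ofReal ((∫ x in Ioc 0 T, K (Z x) * α (prevHill r x) * f x) +
          hillPotential F lam T) := ENNReal.ofReal_le_ofReal (by linarith)
    _ ≤ ENNReal.ofReal (∫ x in Ioc 0 T, K (Z x) * α (prevHill r x) * f x) +
          ENNReal.ofReal (hillPotential F lam T) := ENNReal.ofReal_add_le
    _ ≤ _ := by
      gcongr
      rw [ofReal_integral_eq_lintegral_ofReal hB ((ae_restrict_iff' measurableSet_Ioc).2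
        (Filter.Eventually.of_forall fun x hx =>
          mul_nonneg (mul_nonneg (hK0 _ (hZx x hx).1) (hα0 _)) (hf0 x)))]
      refine (setLIntegral_mono' measurableSet_Ioc fun x hx => ENNReal.ofReal_le_ofReal ?_).trans
        (lintegral_mono_set Ioc_subset_Ioi_self)
      have h := secMom_div_loadComp_le_nextHillT hFc hFa hF0 hFi hlam hc hx.1.le (hZx x hx).1
        fun b hxb hb => csInf_le_csInf ⟨x, fun a ha => ha.1⟩ ⟨b, hxb, hb⟩
          fun a ha => ⟨ha.1, Or.inl ha.2⟩
      refine mul_le_mul_of_nonneg_right ?_ (hf0 x)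
      rw [mul_comm (loadComp F lam (prevHill r x)), ← div_div,
        div_eq_mul_inv _ (loadComp F lam (prevHill r x))]
      exact mul_le_mul_of_nonneg_right h (hα0 _)

end tail

/-- the M-SERPT residence-time integral is bounded by the M-SERPT
waiting-time integral plus `(1/λ)·log(1/(1−ρ))` (as possibly infinite
Lebesgue integrals). -/
theorem stmt6
    (F : ℝ → ℝ) (lam rho : ℝ)
    (hF_diff : ContDiff ℝ 1 F)
    (hF_anti : Antitone F)
    (hF_nonneg : ∀ t, 0 ≤ F t)
    (hF_le_one : ∀ t, F t ≤ 1)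
    (hF_int : IntegrableOn F (Ioi 0))
    (hmean_pos : 0 < ∫ t in Ioi (0:ℝ), F t)
    (hlam : 0 < lam)
    (hrho_def : rho = lam * ∫ t in Ioi (0:ℝ), F t)
    (hrho_lt : rho < 1)
    (hserpt_pm : PiecewiseMonotone (serptRank F))
    (hS_lf : LocFinHillValleyDecomp (serptRank F)) :
    (∫⁻ x in Ioi (0:ℝ),
        ENNReal.ofReal (x / loadComp F lam (prevHill (serptRank F) x) * (-deriv F x)))
      ≤ (∫⁻ x in Ioi (0:ℝ),
          ENNReal.ofReal
            (secMomT F lam (nextHillT (serptRank F) x) /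
                (loadComp F lam (prevHill (serptRank F) x) *
                  loadCompT F lam (nextHillT (serptRank F) x)) *
              (-deriv F x)))
        + ENNReal.ofReal ((1 / lam) * Real.log (1 / (1 - rho))) := by
  subst hrho_def
  have hFc := hF_diff.continuous
  have hc : 0 < 1 - lam * ∫ t in Ioi (0:ℝ), F t := sub_pos.2 hrho_lt
  have hmeas : Measurable fun x : ℝ =>
      ENNReal.ofReal (x / loadComp F lam (prevHill (serptRank F) x) * (-deriv F x)) :=
    ((measurable_id.div ((continuous_loadComp hFc).measurable.comp
      (monotone_prevHill _).measurable)).mul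
        (hF_diff.continuous_deriv le_rfl).measurable.neg).ennreal_ofReal
  have hcover : AECover (volume.restrict (Ioi (0:ℝ))) Filter.atTop fun T : ℝ => Iic T :=
    (aecover_Iic Filter.tendsto_id).restrict
  have hlim := hcover.lintegral_tendsto_of_countably_generated hmeas.aemeasurable
  have hpot : Filter.Tendsto (fun T => 1 / lam * Real.log (1 / (1 - lam * ∫ t in Ioi (0:ℝ), F t)) +
      T * F T / (1 - lam * ∫ t in Ioi (0:ℝ), F t) ^ 2) Filter.atTop
      (nhds (1 / lam * Real.log (1 / (1 - lam * ∫ t in Ioi (0:ℝ), F t)))) := by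
    simpa using ((tendsto_mul_self_atTop_zero hFc hF_anti hF_nonneg hF_int).div_const
      ((1 - lam * ∫ t in Ioi (0:ℝ), F t) ^ 2)).const_add
        (1 / lam * Real.log (1 / (1 - lam * ∫ t in Ioi (0:ℝ), F t)))
  refine le_of_tendsto_of_tendsto hlim ((ENNReal.tendsto_ofReal hpot).const_add _) ?_
  filter_upwards [Filter.eventually_ge_atTop 0] with T hT
  rw [Measure.restrict_restrict measurableSet_Iic, inter_comm, Ioi_inter_Iic]
  refine (lintegral_Ioc_le hF_diff hF_anti hF_nonneg hF_int hlam hc hT).trans ?_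
  gcongr
  exact hillPotential_le hFc hF_nonneg hF_int hlam hc hT
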